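/- arXiv:1104.2463 — 2 statements merged into one kernel-verified Lean document; each statement's English description precedes it below -/
import Mathlib

section
/- Let A be a sequence algebra, and let X and Y be homogeneous normed A-modules of finite type with M_X = M_Y and with the same associated function (f_X = f_Y). Suppose for every n a bounded operator φₙ : Xₙ → Yₙ is given with C := sup_n ‖φₙ‖ < ∞. Then the morphism φ : X → Y defined by φ(x) := Σₙ φₙ(xₙ) is bounded with ‖φ‖ = C. -/
noncomputable section

open Filter Topology

/-- A coisometric (quotient) bounded operator between complex normed spaces. -/
def IsCoisometry {Y X : Type} [NormedAddCommGroup Y] [NormedSpace ℂ Y]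
    [NormedAddCommGroup X] [NormedSpace ℂ X] (τ : Y →L[ℂ] X) : Prop :=
  (∀ y : Y, ‖τ y‖ ≤ ‖y‖) ∧ ∀ x : X, ∀ ε : ℝ, 0 < ε → ∃ y : Y, τ y = x ∧ ‖y‖ < ‖x‖ + ε

/-- Extreme (metric) projectivity in the category Nor of all complex normed spaces. -/
def ExtremelyProjectiveNor (P : Type) [NormedAddCommGroup P] [NormedSpace ℂ P] : Prop :=
  ∀ (Y X : Type) [NormedAddCommGroup Y] [NormedSpace ℂ Y]
    [NormedAddCommGroup X] [NormedSpace ℂ X],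
    ∀ τ : Y →L[ℂ] X, IsCoisometry τ →
      ∀ φ : P →L[ℂ] X, ∀ ε : ℝ, 0 < ε →
        ∃ ψ : P →L[ℂ] Y, τ.comp ψ = φ ∧ ‖ψ‖ < ‖φ‖ + ε

/-- Topological projectivity in Nor. -/
def TopologicallyProjectiveNor (P : Type) [NormedAddCommGroup P] [NormedSpace ℂ P] : Prop :=
  ∀ (Y X : Type) [NormedAddCommGroup Y] [NormedSpace ℂ Y]
    [NormedAddCommGroup X] [NormedSpace ℂ X],
    ∀ τ : Y →L[ℂ] X, IsCoisometry τ →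
      ∀ φ : P →L[ℂ] X, ∃ ψ : P →L[ℂ] Y, τ.comp ψ = φ

/-- A (contractive, non-degenerate in no way assumed) normed left module over a
(not necessarily unital) complex normed algebra `A`. -/
structure NormedMod (A : Type) [NonUnitalNormedRing A] [NormedSpace ℂ A] : Type 1 where
  X : Type
  [grp : NormedAddCommGroup X]
  [sp : NormedSpace ℂ X]
  smul : A → X → X
  smul_add : ∀ (a : A) (x y : X), smul a (x + y) = smul a x + smul a y
  add_smul : ∀ (a b : A) (x : X), smul (a + b) x = smul a x + smul b x
  smul_csmul : ∀ (c : ℂ) (a : A) (x : X), smul a (c • x) = c • smul a x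
  csmul_smul : ∀ (c : ℂ) (a : A) (x : X), smul (c • a) x = c • smul a x
  mul_smul : ∀ (a b : A) (x : X), smul (a * b) x = smul a (smul b x)
  norm_smul_le : ∀ (a : A) (x : X), ‖smul a x‖ ≤ ‖a‖ * ‖x‖

attribute [instance] NormedMod.grp NormedMod.sp

variable {A : Type} [NonUnitalNormedRing A] [NormedSpace ℂ A]
  [IsScalarTower ℂ A A] [SMulCommClass ℂ A A]

/-- Bounded `A`-module morphism property for a bounded operator between the underlying spaces. -/
def IsMor (M N : NormedMod A) (f : M.X →L[ℂ] N.X) : Prop :=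
  ∀ (a : A) (x : M.X), f (M.smul a x) = N.smul a (f x)

/-- Extreme (metric) projectivity of a normed `A`-module with respect to a class `K`
of normed `A`-modules. -/
def ExtremelyProjective (P : NormedMod A) (K : NormedMod A → Prop) : Prop :=
  ∀ (MY MX : NormedMod A), K MY → K MX →
    ∀ τ : MY.X →L[ℂ] MX.X, IsMor MY MX τ → IsCoisometry τ →
      ∀ φ : P.X →L[ℂ] MX.X, IsMor P MX φ → ∀ ε : ℝ, 0 < ε →
        ∃ ψ : P.X →L[ℂ] MY.X, IsMor P MY ψ ∧ τ.comp ψ = φ ∧ ‖ψ‖ < ‖φ‖ + ε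

/-- Topological projectivity of a normed `A`-module with respect to a class `K`. -/
def TopologicallyProjective (P : NormedMod A) (K : NormedMod A → Prop) : Prop :=
  ∀ (MY MX : NormedMod A), K MY → K MX →
    ∀ τ : MY.X →L[ℂ] MX.X, IsMor MY MX τ → IsCoisometry τ →
      ∀ φ : P.X →L[ℂ] MX.X, IsMor P MX φ →
        ∃ ψ : P.X →L[ℂ] MY.X, IsMor P MY ψ ∧ τ.comp ψ = φ

/-- A sequence algebra: a normed algebra `A` realized (injectively, by `coords`) as an
algebra of complex sequences with coordinatewise operations, containing the elements
`p n` (the sequences with a single entry `1` in position `n`, which span `c₀₀`) so that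
`c₀₀` is dense and `‖p n‖ = 1`. -/
structure SequenceAlgebra (A : Type) [NonUnitalNormedRing A] [NormedSpace ℂ A] : Type where
  coords : A →ₗ[ℂ] (ℕ → ℂ)
  coords_injective : Function.Injective coords
  coords_mul : ∀ a b : A, coords (a * b) = coords a * coords b
  p : ℕ → A
  coords_p : ∀ n : ℕ, coords (p n) = fun m => if m = n then (1 : ℂ) else 0
  norm_p : ∀ n : ℕ, ‖p n‖ = 1
  dense_c00 : Dense (↑(Submodule.span ℂ (Set.range p)) : Set A)

variable (SA : SequenceAlgebra A)

/-- The action of a fixed `a : A` as a `ℂ`-linear map on a normed `A`-module. -/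
def NormedMod.smulLM (M : NormedMod A) (a : A) : M.X →ₗ[ℂ] M.X where
  toFun := M.smul a
  map_add' := M.smul_add a
  map_smul' := fun c x => M.smul_csmul c a x

/-- The `n`-th coordinate subspace `Xₙ = {pⁿ · x : x ∈ X}` of a normed `A`-module. -/
def coordSub (M : NormedMod A) (n : ℕ) : Submodule ℂ M.X :=
  LinearMap.range (M.smulLM (SA.p n))

/-- A normed `A`-module is essential (non-degenerate) if the closed linear span of
`{a · x}` is everything. -/
def NormedMod.Essential (M : NormedMod A) : Prop :=
  Dense (↑(Submodule.span ℂ {y : M.X | ∃ (a : A) (x : M.X), y = M.smul a x}) : Set M.X)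

/-- Homogeneity: the norm of an element is monotonely determined by the norms of
its coordinates. -/
def Homogeneous (M : NormedMod A) : Prop :=
  ∀ x y : M.X, (∀ n : ℕ, ‖M.smul (SA.p n) x‖ ≤ ‖M.smul (SA.p n) y‖) → ‖x‖ ≤ ‖y‖

/-- An element is finite if its coordinates eventually vanish. -/
def FiniteElt (M : NormedMod A) (x : M.X) : Prop :=
  ∃ N : ℕ, ∀ n : ℕ, N ≤ n → M.smul (SA.p n) x = 0

/-- A module has finite type if all its elements are finite, i.e. `X = X₀₀`. -/
def FiniteType (M : NormedMod A) : Prop :=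
  ∀ x : M.X, FiniteElt SA M x


/-- Finite type in the strong sense for normed modules. -/
def FiniteTypeSum (M : NormedMod A) : Prop :=
  ∀ x : M.X, ∃ N : ℕ, (∀ n : ℕ, N ≤ n → M.smul (SA.p n) x = 0) ∧
    x = ∑ n ∈ Finset.range N, M.smul (SA.p n) x

namespace NormedMod

variable {B : Type} [NonUnitalNormedRing B] [NormedSpace ℂ B]

theorem smul_zero (M : NormedMod B) (a : B) : M.smul a 0 = 0 :=
  map_zero (M.smulLM a)

theorem zero_smul (M : NormedMod B) (x : M.X) : M.smul 0 x = 0 := by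
  simpa using M.csmul_smul 0 0 x

theorem smul_sub (M : NormedMod B) (a : B) (x y : M.X) :
    M.smul a (x - y) = M.smul a x - M.smul a y :=
  map_sub (M.smulLM a) x y

theorem smul_sum (M : NormedMod B) (a : B) (s : Finset ℕ) (x : ℕ → M.X) :
    M.smul a (∑ n ∈ s, x n) = ∑ n ∈ s, M.smul a (x n) :=
  map_sum (M.smulLM a) x s

end NormedMod

section Coordinates

variable {B : Type} [NonUnitalNormedRing B] [NormedSpace ℂ B] {S : SequenceAlgebra B}

theorem SequenceAlgebra.p_mul_p (S : SequenceAlgebra B) (m n : ℕ) :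
    S.p m * S.p n = if m = n then S.p n else 0 := by
  apply S.coords_injective
  ext k
  rw [S.coords_mul]
  split_ifs with h
  · subst h
    simp [S.coords_p]
  · simp only [S.coords_p, Pi.mul_apply, map_zero, Pi.zero_apply]
    grind

theorem NormedMod.p_smul_of_mem {M : NormedMod B} {n : ℕ} {x : M.X}
    (hx : x ∈ coordSub S M n) (m : ℕ) :
    M.smul (S.p m) x = if m = n then x else 0 := by
  obtain ⟨z, rfl⟩ := hx
  change M.smul (S.p m) (M.smul (S.p n) z) = if m = n then M.smul (S.p n) z else 0
  rw [← M.mul_smul, S.p_mul_p]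
  split_ifs
  · rfl
  · exact M.zero_smul z

/-- In a homogeneous module an element is determined by its coordinates. -/
theorem Homogeneous.ext {M : NormedMod B} (h : Homogeneous S M) {x y : M.X}
    (hxy : ∀ n, M.smul (S.p n) x = M.smul (S.p n) y) : x = y := by
  have h0 : ‖x - y‖ ≤ ‖(0 : M.X)‖ := h _ _ fun n => by
    simp [M.smul_sub, hxy, M.smul_zero]
  rw [norm_zero, norm_le_zero_iff] at h0
  exact sub_eq_zero.mp h0

/-- A sequence of norms realized by an element of a module of finite type is realized in every
module having at least the same nonzero coordinate subspaces. -/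
theorem exists_norm_coord_eq {M N : NormedMod B} (hM : FiniteTypeSum S M)
    (hMN : ∀ n, coordSub S N n = ⊥ → coordSub S M n = ⊥) (x : M.X) :
    ∃ y : N.X, ∀ n, ‖M.smul (S.p n) x‖ = ‖N.smul (S.p n) y‖ := by
  have hz : ∀ n, ∃ z ∈ coordSub S N n, ‖z‖ = ‖M.smul (S.p n) x‖ := by
    intro n
    by_cases hn : coordSub S N n = ⊥
    · have hx : M.smul (S.p n) x ∈ coordSub S M n := ⟨x, rfl⟩
      rw [hMN n hn, Submodule.mem_bot] at hx
      exact ⟨0, zero_mem _, by simp [hx]⟩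
    · obtain ⟨w, hw, hw0⟩ := Submodule.exists_mem_ne_zero_of_ne_bot hn
      refine ⟨((‖M.smul (S.p n) x‖ / ‖w‖ : ℝ) : ℂ) • w, Submodule.smul_mem _ _ hw, ?_⟩
      have : ‖w‖ ≠ 0 := norm_ne_zero_iff.mpr hw0
      rw [norm_smul, Complex.norm_real, Real.norm_of_nonneg (by positivity)]
      field_simp
  choose z hz hzx using hz
  obtain ⟨K, hK, -⟩ := hM x
  refine ⟨∑ k ∈ Finset.range K, z k, fun n => ?_⟩
  simp only [N.smul_sum, NormedMod.p_smul_of_mem (hz _), Finset.sum_ite_eq, Finset.mem_range]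
  split_ifs with h
  · exact (hzx n).symm
  · simp [hK n (not_lt.mp h)]

end Coordinates

/-- Proposition 1.11: let `X`, `Y` be homogeneous normed modules of finite type over a
sequence algebra with `M_X = M_Y` and the same associated function, and let
`φₙ : Xₙ → Yₙ` be bounded operators with `C = sup ‖φₙ‖ < ∞`. Then the morphism
generated by the `φₙ` (i.e. the linear map `φ` with `φ(x)ₙ = φₙ(xₙ)`) is bounded with
norm `C`. -/
theorem generated_morphism_norm
    (M N : NormedMod A)
    (hhomM : Homogeneous SA M) (hhomN : Homogeneous SA N)
    (hftM : FiniteTypeSum SA M) (hftN : FiniteTypeSum SA N)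
    (hMN : ∀ n : ℕ, coordSub SA M n = ⊥ ↔ coordSub SA N n = ⊥)
    (hsame : ∀ (x : M.X) (y : N.X),
      (∀ n : ℕ, ‖M.smul (SA.p n) x‖ = ‖N.smul (SA.p n) y‖) → ‖x‖ = ‖y‖)
    (φn : ∀ n : ℕ, ↥(coordSub SA M n) →L[ℂ] ↥(coordSub SA N n))
    (C : ℝ) (hC : IsLUB (Set.range fun n : ℕ => ‖φn n‖) C)
    (φ : M.X →ₗ[ℂ] N.X)
    (hφ : ∀ (x : M.X) (n : ℕ),
      N.smul (SA.p n) (φ x) =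
        ((φn n) ⟨M.smul (SA.p n) x, LinearMap.mem_range_self _ x⟩ : N.X)) :
    ∃ ψ : M.X →L[ℂ] N.X, (∀ x : M.X, ψ x = φ x) ∧ ‖ψ‖ = C := by
  have hle : ∀ n, ‖φn n‖ ≤ C := fun n => hC.1 ⟨n, rfl⟩
  have hC0 : 0 ≤ C := (φn 0).opNorm_nonneg.trans (hle 0)
  have hbound : ∀ x, ‖φ x‖ ≤ C * ‖x‖ := by
    intro x
    obtain ⟨y, hy⟩ := exists_norm_coord_eq hftM (fun n => (hMN n).mpr) x
    rw [hsame x y hy, ← Real.norm_of_nonneg hC0, ← Complex.norm_real, ← norm_smul]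
    refine hhomN _ _ fun n => ?_
    rw [hφ, N.smul_csmul, norm_smul, Complex.norm_real, Real.norm_of_nonneg hC0, ← hy]
    exact (φn n).le_of_opNorm_le (hle n) _
  refine ⟨φ.mkContinuous C hbound, fun _ => rfl, le_antisymm ?_ (hC.2 ?_)⟩
  · exact φ.mkContinuous_norm_le hC0 hbound
  rintro _ ⟨n, rfl⟩
  refine (φn n).opNorm_le_bound (norm_nonneg _) fun u => ?_
  have hu : φ u = φn n u := by
    refine hhomN.ext fun m => ?_
    rw [hφ, NormedMod.p_smul_of_mem (φn n u).2]
    simp only [NormedMod.p_smul_of_mem u.2]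
    split_ifs with h
    · subst h
      rfl
    · exact congrArg Subtype.val (map_zero (φn m))
  have := (φ.mkContinuous C hbound).le_opNorm u
  rwa [LinearMap.mkContinuous_apply, hu] at this


end
end

section
/- For every infinite index set Λ, the Banach space l₁(Λ) is not topologically projective in Nor, and hence not extremely projective in Nor. -/
noncomputable section

instance : Fact ((1 : ENNReal) ≤ 1) := ⟨le_rfl⟩

/-- The Banach space `l₁(Λ)` of absolutely summable complex functions on `Λ`. -/
abbrev l1Space (Λ : Type) : Type := lp (fun _ : Λ => ℂ) 1

/-- The canonical basis vector `e_ν` in `l₁(Λ)`. -/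
def l1single (Λ : Type) (ν : Λ) : l1Space Λ :=
  letI : DecidableEq Λ := Classical.decEq Λ
  lp.single 1 ν (1 : ℂ)

/-- The subspace `l₁⁰(Λ)` of finitely supported functions, i.e. the linear span
of the canonical basis vectors, with the `l₁`-norm. -/
def l10 (Λ : Type) : Submodule ℂ (l1Space Λ) :=
  Submodule.span ℂ (Set.range (l1single Λ))

/-- The canonical basis vector `e_ν` as an element of `l₁⁰(Λ)`. -/
def l10e (Λ : Type) (ν : Λ) : ↥(l10 Λ) :=
  ⟨l1single Λ ν, Submodule.subset_span ⟨ν, rfl⟩⟩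

open Topology in
/-- If pointwise only finitely many members of a family of continuous functionals on a Banach space
are nonzero, then all but finitely many of the functionals vanish. -/
theorem finite_ne_zero_of_pointwise_finite {E S : Type*} [NormedAddCommGroup E] [NormedSpace ℂ E]
    [CompleteSpace E] (c : S → E →L[ℂ] ℂ) (hc : ∀ x, {s | c s x ≠ 0}.Finite) :
    {s | c s ≠ 0}.Finite := by
  classical
  let A : ℕ → Set E := fun n =>
    ⋂ t : Finset S, ⋂ _ : t.card = n + 1, ⋃ s ∈ t, {x | c s x = 0}
  have hA : ∀ n x, x ∈ A n ↔ {s | c s x ≠ 0}.ncard ≤ n := by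
    intro n x
    simp only [A, Set.mem_iInter, Set.mem_iUnion, Set.mem_ofPred_eq, exists_prop]
    constructor
    · intro h
      by_contra! hlt
      rw [Set.ncard_eq_toFinset_card _ (hc x)] at hlt
      obtain ⟨t, ht, htc⟩ := Finset.exists_subset_card_eq (Nat.succ_le_of_lt hlt)
      obtain ⟨s, hs, hs0⟩ := h t htc
      have := ht hs
      simp only [Set.Finite.mem_toFinset, Set.mem_ofPred_eq] at this
      exact this hs0
    · intro h t ht
      by_contra! hne
      have := Set.ncard_le_ncard (t := {s | c s x ≠ 0}) (s := (t : Set S))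
        (fun s hs => hne s hs) (hc x)
      rw [Set.ncard_coe_finset] at this
      omega
  have hclosed : ∀ n, IsClosed (A n) := fun n =>
    isClosed_iInter fun t => isClosed_iInter fun _ =>
      t.finite_toSet.isClosed_biUnion fun s _ => isClosed_eq (c s).continuous continuous_const
  obtain ⟨n, hn⟩ := nonempty_interior_of_iUnion_of_closed hclosed
    (Set.eq_univ_of_forall fun x => Set.mem_iUnion.2 ⟨_, (hA _ x).2 le_rfl⟩)
  obtain ⟨x, hxU, hmin⟩ := exists_minimalFor_of_wellFoundedLT (· ∈ interior (A n))
    (fun x => n - {s | c s x ≠ 0}.ncard) hn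
  refine (hc x).subset fun s hs hsx => hs ?_
  ext y
  by_contra hy
  have hcont : Continuous fun t : ℂ => x + t • y := by fun_prop
  have hU : ∀ᶠ t : ℂ in 𝓝 0, x + t • y ∈ interior (A n) :=
    hcont.continuousAt.eventually_mem (isOpen_interior.mem_nhds (by simpa using hxU))
  have hsupp : ∀ᶠ t : ℂ in 𝓝 0, ∀ r ∈ {s | c s x ≠ 0}, c r (x + t • y) ≠ 0 :=
    (hc x).eventually_all.2 fun r hr =>
      ((c r).continuous.comp hcont).continuousAt.eventually_ne (by simpa using hr)
  obtain ⟨t, ⟨htU, htsupp⟩, ht⟩ :=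
    (((hU.and hsupp).filter_mono nhdsWithin_le_nhds).and
      (self_mem_nhdsWithin (a := (0 : ℂ)) (s := {0}ᶜ))).exists
  have hsub : insert s {s | c s x ≠ 0} ⊆ {s | c s (x + t • y) ≠ 0} := by
    rintro r (rfl | hr)
    · have hsx' : c r x = 0 := hsx
      simpa [hsx'] using And.intro ht hy
    · exact htsupp r hr
  have hcard := Set.ncard_le_ncard hsub (hc _)
  rw [Set.ncard_insert_of_notMem (by simpa using hsx) (hc x)] at hcard
  have hle := (hA n _).1 (interior_subset htU)
  have hlt : n - {s | c s (x + t • y) ≠ 0}.ncard < n - {s | c s x ≠ 0}.ncard := by omega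
  exact hlt.not_ge (hmin htU hlt.le)

theorem l1Space_hasSum_norm {S : Type} (f : l1Space S) : HasSum (fun s => ‖f s‖) ‖f‖ := by
  simpa using lp.hasSum_norm (p := 1) (by simp) f

theorem norm_smul_le_of_norm_le_one {X : Type} [NormedAddCommGroup X] [NormedSpace ℂ X] (a : ℂ)
    {x : X} (hx : ‖x‖ ≤ 1) : ‖a • x‖ ≤ ‖a‖ := by
  rw [norm_smul]
  exact mul_le_of_le_one_right (norm_nonneg _) hx

/-- The contraction `l₁(S) → X` sending `e_s` to `v s`, for a family `v` in the unit ball. -/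
def l1Lift {S X : Type} [NormedAddCommGroup X] [NormedSpace ℂ X] [CompleteSpace X]
    (v : S → X) (hv : ∀ s, ‖v s‖ ≤ 1) : l1Space S →L[ℂ] X :=
  have hsum : ∀ f : l1Space S, Summable fun s => f s • v s := fun f =>
    (l1Space_hasSum_norm f).summable.of_norm_bounded
      fun s => norm_smul_le_of_norm_le_one (f s) (hv s)
  LinearMap.mkContinuous
    { toFun := fun f => ∑' s, f s • v s
      map_add' := fun f g => by
        rw [← (hsum f).tsum_add (hsum g)]
        simp [add_smul]
      map_smul' := fun a f => by
        rw [RingHom.id_apply, ← (hsum f).tsum_const_smul]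
        simp [mul_smul] } 1 fun f => by
    rw [one_mul]
    exact tsum_of_norm_bounded (l1Space_hasSum_norm f)
      fun s => norm_smul_le_of_norm_le_one (f s) (hv s)

theorem norm_l1Lift_apply_le {S X : Type} [NormedAddCommGroup X] [NormedSpace ℂ X]
    [CompleteSpace X] (v : S → X) (hv : ∀ s, ‖v s‖ ≤ 1) (f : l1Space S) :
    ‖l1Lift v hv f‖ ≤ ‖f‖ :=
  tsum_of_norm_bounded (l1Space_hasSum_norm f)
    fun s => norm_smul_le_of_norm_le_one (f s) (hv s)

theorem l1Lift_single {S X : Type} [NormedAddCommGroup X] [NormedSpace ℂ X]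
    [CompleteSpace X] (v : S → X) (hv : ∀ s, ‖v s‖ ≤ 1) (s : S) :
    l1Lift v hv (l1single S s) = v s := by
  change ∑' r, l1single S s r • v r = v s
  rw [tsum_eq_single s]
  · simp [l1single]
  · intro r hr
    simp [l1single, hr]

theorem norm_l1single (S : Type) (s : S) : ‖l1single S s‖ = 1 := by
  classical
  simp [l1single, lp.norm_single]

theorem finite_support_of_mem_l10 {S : Type} {f : l1Space S} (hf : f ∈ l10 S) :
    {s | f s ≠ 0}.Finite := by
  induction hf using Submodule.span_induction with
  | mem f h =>
    obtain ⟨r, rfl⟩ := h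
    refine (Set.finite_singleton r).subset fun s hs => ?_
    by_contra hsr
    exact hs (by simp [l1single, show s ≠ r from hsr])
  | zero => simp
  | add f g _ _ hf hg =>
    refine (hf.union hg).subset fun s hs => ?_
    by_contra h
    simp only [Set.mem_union, Set.mem_ofPred_eq, not_or, not_not] at h
    exact hs (by simp [h.1, h.2])
  | smul a f _ hf =>
    refine hf.subset fun s hs h => hs ?_
    simp [h]

theorem linearIndependent_l1single (Λ : Type) : LinearIndependent ℂ (l1single Λ) := by
  classical
  rw [linearIndependent_iff']
  intro t g hg i hi
  have := congrArg (lp.evalCLM ℂ (fun _ : Λ => ℂ) 1 i) hg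
  rw [map_sum, map_zero, Finset.sum_eq_single i] at this
  · simpa [lp.evalCLM, l1single] using this
  · intro j _ hj
    simp [lp.evalCLM, l1single, hj.symm]
  · exact fun h => (h hi).elim

/-- The canonical operator from `l₁⁰` of the closed unit ball of a Banach space onto that space. -/
def unitBallQuotient (X : Type) [NormedAddCommGroup X] [NormedSpace ℂ X] [CompleteSpace X] :
    l10 {x : X // ‖x‖ ≤ 1} →L[ℂ] X :=
  (l1Lift (S := {x : X // ‖x‖ ≤ 1}) Subtype.val Subtype.prop).comp (l10 _).subtypeL

theorem isCoisometry_unitBallQuotient (X : Type) [NormedAddCommGroup X] [NormedSpace ℂ X]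
    [CompleteSpace X] : IsCoisometry (unitBallQuotient X) := by
  refine ⟨fun y => norm_l1Lift_apply_le Subtype.val Subtype.prop y.1, fun x ε hε => ?_⟩
  obtain rfl | hx := eq_or_ne x 0
  · exact ⟨0, by simp, by simpa using hε⟩
  have hx' : ‖x‖ ≠ 0 := norm_ne_zero_iff.2 hx
  let u : {x : X // ‖x‖ ≤ 1} := ⟨((‖x‖⁻¹ : ℝ) : ℂ) • x, by simp [norm_smul, hx']⟩
  refine ⟨((‖x‖ : ℝ) : ℂ) • l10e _ u, ?_, ?_⟩
  · have : unitBallQuotient X (l10e _ u) = u := l1Lift_single Subtype.val Subtype.prop u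
    rw [map_smul, this]
    simp [u, smul_smul, hx']
  · have : ‖l10e _ u‖ = 1 := norm_l1single _ u
    rw [norm_smul, this]
    simpa using hε

/-- A Banach space that is topologically projective in Nor is finite-dimensional. -/
theorem TopologicallyProjectiveNor.finiteDimensional {P : Type} [NormedAddCommGroup P]
    [NormedSpace ℂ P] [CompleteSpace P] (h : TopologicallyProjectiveNor P) :
    FiniteDimensional ℂ P := by
  obtain ⟨ψ, hψ⟩ := h _ _ (unitBallQuotient P) (isCoisometry_unitBallQuotient P)
    (ContinuousLinearMap.id ℂ P)
  let c : {x : P // ‖x‖ ≤ 1} → P →L[ℂ] ℂ := fun s =>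
    (lp.evalCLM ℂ (fun _ : {x : P // ‖x‖ ≤ 1} => ℂ) 1 s).comp ((l10 _).subtypeL.comp ψ)
  have hfin : {s | c s ≠ 0}.Finite :=
    finite_ne_zero_of_pointwise_finite c fun x => finite_support_of_mem_l10 (ψ x).2
  have := hfin.to_subtype
  let L : P →ₗ[ℂ] ({s | c s ≠ 0} → ℂ) := LinearMap.pi fun s => (c s : P →ₗ[ℂ] ℂ)
  refine FiniteDimensional.of_injective L ((injective_iff_map_eq_zero L).2 fun x hx => ?_)
  have hψx : ψ x = 0 := by
    ext s
    change c s x = 0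
    by_cases hs : c s = 0
    · simp [hs]
    · exact congrFun hx ⟨s, hs⟩
  have := DFunLike.congr_fun hψ x
  simpa [hψx] using this.symm

theorem ExtremelyProjectiveNor.topologicallyProjectiveNor {P : Type} [NormedAddCommGroup P]
    [NormedSpace ℂ P] (h : ExtremelyProjectiveNor P) : TopologicallyProjectiveNor P := by
  intro Y X _ _ _ _ τ hτ φ
  obtain ⟨ψ, hψ, -⟩ := h Y X τ hτ φ 1 one_pos
  exact ⟨ψ, hψ⟩

/-- For every infinite index set `Λ`, the Banach space `l₁(Λ)` is not topologically
projective in Nor, and hence not extremely projective in Nor. -/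
theorem l1_not_projectiveNor (Λ : Type) [Infinite Λ] :
    ¬ TopologicallyProjectiveNor (l1Space Λ) ∧ ¬ ExtremelyProjectiveNor (l1Space Λ) := by
  have key : ¬ TopologicallyProjectiveNor (l1Space Λ) := fun h => by
    have := h.finiteDimensional
    have := (linearIndependent_l1single Λ).finite
    exact not_finite Λ
  exact ⟨key, fun h => key h.topologicallyProjectiveNor⟩

end
end
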